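/- For every n ≥ 1 and every rational m, the resultant of r^{(n)}(X) and f_m^{(n)}(X) equals 3^{n(n−1)/2}·(−1)^{n(n+1)/2}. -/

import Mathlib

open Polynomial

/-- h(i) = 0, -1, -1, 0, 1, 1 according as i = 0,1,2,3,4,5 (mod 6). -/
def hcoef (i : ℕ) : ℤ :=
  match i % 6 with
  | 0 => 0 | 1 => -1 | 2 => -1 | 3 => 0 | 4 => 1 | _ => 1

/-- g(i) = 1, -m, -m-1, -1, m, m+1 according as i = 0,1,2,3,4,5 (mod 6). -/
def gcoef (m : ℚ) (i : ℕ) : ℚ :=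
  match i % 6 with
  | 0 => 1 | 1 => -m | 2 => -m - 1 | 3 => -1 | 4 => m | _ => m + 1

/-- f_m^{(n)}(X) = sum_{i=0}^n C(n,i) X^i g(n-i). -/
noncomputable def fpol (m : ℚ) (n : ℕ) : ℚ[X] :=
  ∑ i ∈ Finset.range (n + 1), C ((n.choose i : ℚ) * gcoef m (n - i)) * X ^ i

/-- r^{(n)}(X) = sum_{i=0}^n C(n,i) X^i h(n-i). -/
noncomputable def rpol (n : ℕ) : ℤ[X] :=
  ∑ i ∈ Finset.range (n + 1), C ((n.choose i : ℤ) * hcoef (n - i)) * X ^ i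

/-- Sylvester matrix of `f` (regarded as of degree `m`) and `g` (regarded as of
degree `n`): the first `n` rows contain the coefficients of `f` (in decreasing
order, shifted), the last `m` rows those of `g`. -/
def sylvester {R : Type*} [CommRing R] (m n : ℕ) (f g : R[X]) :
    Matrix (Fin (n + m)) (Fin (n + m)) R :=
  Matrix.of fun i j =>
    if (i : ℕ) < n then
      (if (i : ℕ) ≤ (j : ℕ) ∧ (j : ℕ) ≤ (i : ℕ) + m then f.coeff (m + i - j) else 0)
    else
      (if (i : ℕ) - n ≤ (j : ℕ) ∧ (j : ℕ) ≤ ((i : ℕ) - n) + n then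
        g.coeff (n + ((i : ℕ) - n) - j) else 0)

/-- The resultant of `f` (of degree `m`) and `g` (of degree `n`), as the
determinant of the Sylvester matrix. -/
def res {R : Type*} [CommRing R] (m n : ℕ) (f g : R[X]) : R :=
  (sylvester m n f g).det

theorem res_eq_resultant {R : Type*} [CommRing R] (m n : ℕ) (f g : R[X]) :
    res m n f g = f.resultant g m n := by
  let e : Fin (n + m) ≃ Fin (m + n) := Fin.revPerm.trans (finCongr (add_comm n m))
  rw [res, Polynomial.resultant, ← Matrix.det_transpose (Polynomial.sylvester f g m n),
    ← Matrix.det_submatrix_equiv_self e]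
  congr 1
  ext i j
  have hj : (e j : ℕ) = n + m - (j + 1) := by simp [e, Fin.val_rev]
  have hi : (e i : ℕ) = n + m - (i + 1) := by simp [e, Fin.val_rev]
  simp only [_root_.sylvester, Polynomial.sylvester, Matrix.of_apply, Matrix.submatrix_apply,
    Matrix.transpose_apply, Set.mem_Icc, hj]
  by_cases h : (i : ℕ) < n
  · have he : e i = Fin.natAdd m ⟨n - (i + 1), by omega⟩ := by
      ext
      simp only [hi, Fin.val_natAdd]
      omega
    rw [he, Fin.addCases_right, if_pos h]
    dsimp only
    split_ifs
    · congr 1; omega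
    all_goals first | rfl | (exfalso; omega)
  · have he : e i = Fin.castAdd n ⟨n + m - (i + 1), by omega⟩ := by
      ext
      simp only [hi, Fin.val_castAdd]
    rw [he, Fin.addCases_left, if_neg h]
    dsimp only
    split_ifs
    · congr 1; omega
    all_goals first | rfl | (exfalso; omega)

theorem hcoef_add_two (i : ℕ) : hcoef (i + 2) = hcoef (i + 1) - hcoef i := by
  have h : i % 6 < 6 := Nat.mod_lt _ (by norm_num)
  simp only [hcoef, Nat.add_mod i]
  interval_cases i % 6 <;> rfl

theorem gcoef_add_two (m : ℚ) (i : ℕ) :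
    gcoef m (i + 2) = gcoef m (i + 1) - gcoef m i := by
  have h : i % 6 < 6 := Nat.mod_lt _ (by norm_num)
  simp only [gcoef, Nat.add_mod i]
  interval_cases i % 6 <;> norm_num <;> ring

section

variable {K : Type*} [CommRing K] {z : K}

theorem pow_add_two_of_sq (hz : z ^ 2 = z - 1) (i : ℕ) : z ^ (i + 2) = z ^ (i + 1) - z ^ i := by
  linear_combination z ^ i * hz

theorem mul_hcoef_eq (hz : z ^ 2 = z - 1) (i : ℕ) :
    (1 - 2 * z) * (hcoef i : K) = z ^ i - (1 - z) ^ i := by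
  have hw : (1 - z) ^ 2 = (1 - z) - 1 := by linear_combination hz
  induction i using Nat.twoStepInduction with
  | zero => simp [hcoef]
  | one => simp [hcoef]; ring
  | more i h0 h1 =>
    rw [pow_add_two_of_sq hz, pow_add_two_of_sq hw, hcoef_add_two]
    push_cast
    linear_combination h1 - h0

theorem gcoef_eq [Algebra ℚ K] (hz : z ^ 2 = z - 1) (m : ℚ) (i : ℕ) :
    algebraMap ℚ K (gcoef m i) = z ^ i + (z + algebraMap ℚ K m) * (hcoef i : K) := by
  induction i using Nat.twoStepInduction with
  | zero => simp [hcoef, gcoef]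
  | one => simp [hcoef, gcoef]
  | more i h0 h1 =>
    rw [pow_add_two_of_sq hz, gcoef_add_two, hcoef_add_two]
    push_cast [map_sub]
    linear_combination h1 - h0

theorem X_add_C_pow_eq_sum (z : K) (n : ℕ) :
    (X + C z) ^ n = ∑ i ∈ Finset.range (n + 1), C ((n.choose i : K) * z ^ (n - i)) * X ^ i := by
  rw [add_pow]
  refine Finset.sum_congr rfl fun i _ => ?_
  simp only [C_mul, C_pow, C_eq_natCast]
  ring

theorem map_rpol (n : ℕ) : (rpol n).map (Int.castRingHom K) =
    ∑ i ∈ Finset.range (n + 1), C ((n.choose i : K) * (hcoef (n - i) : K)) * X ^ i := by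
  simp [rpol, Polynomial.map_sum]

theorem map_fpol [Algebra ℚ K] (hz : z ^ 2 = z - 1) (m : ℚ) (n : ℕ) :
    (fpol m n).map (algebraMap ℚ K) = (X + C z) ^ n +
      (rpol n).map (Int.castRingHom K) * C (z + algebraMap ℚ K m) := by
  rw [map_rpol, X_add_C_pow_eq_sum, fpol, Polynomial.map_sum, Finset.sum_mul,
    ← Finset.sum_add_distrib]
  refine Finset.sum_congr rfl fun i _ => ?_
  rw [Polynomial.map_mul, Polynomial.map_pow, map_X, map_C, map_mul, map_natCast, gcoef_eq hz]
  simp only [C_mul, C_add]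
  ring

theorem C_mul_map_rpol (hz : z ^ 2 = z - 1) (n : ℕ) :
    C (1 - 2 * z) * (rpol n).map (Int.castRingHom K) = (X + C z) ^ n - (X + C (1 - z)) ^ n := by
  rw [map_rpol, X_add_C_pow_eq_sum, X_add_C_pow_eq_sum, Finset.mul_sum,
    ← Finset.sum_sub_distrib]
  refine Finset.sum_congr rfl fun i _ => ?_
  rw [← sub_mul, ← C_sub, ← mul_sub, ← mul_hcoef_eq hz, ← mul_assoc, ← C_mul]
  congr 2
  ring

theorem natDegree_rpol_le (n : ℕ) : (rpol n).natDegree ≤ n - 1 := by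
  refine natDegree_sum_le_of_forall_le _ _ fun i hi => ?_
  rcases (Nat.lt_succ_iff.mp (Finset.mem_range.mp hi)).eq_or_lt with rfl | h
  · simp [hcoef]
  · exact (natDegree_C_mul_X_pow_le _ _).trans (by omega)

theorem resultant_rpol_X_add_C_pow [IsDomain K] (hz : z ^ 2 = z - 1) (h3 : (3 : K) ≠ 0)
    {n : ℕ} (hn : 1 ≤ n) :
    ((rpol n).map (Int.castRingHom K)).resultant ((X + C z) ^ n) (n - 1) n =
      3 ^ (n * (n - 1) / 2) * (-1) ^ (n * (n + 1) / 2) := by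
  obtain ⟨k, rfl⟩ := Nat.exists_eq_add_of_le' hn
  have hd : (1 - 2 * z) ^ 2 = -3 := by linear_combination 4 * hz
  have hd0 : 1 - 2 * z ≠ 0 := by
    intro h
    rw [h] at hd
    exact h3 (by linear_combination hd)
  have hev : ((rpol (k + 1)).map (Int.castRingHom K)).eval (-z) = -(1 - 2 * z) ^ k := by
    have h := congrArg (eval (-z)) (C_mul_map_rpol hz (k + 1))
    simp only [eval_mul, eval_C, eval_sub, eval_pow, eval_add, eval_X] at h
    apply mul_left_cancel₀ hd0
    rw [h, neg_add_cancel, zero_pow k.succ_ne_zero]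
    ring
  rw [← sub_neg_eq_add X, ← C_neg, resultant_X_sub_C_pow_right _ _ _ _
    (natDegree_map_le.trans (natDegree_rpol_le _)), hev]
  obtain ⟨t, ht⟩ := Nat.even_mul_succ_self k
  have h1 : (k + 1) * (k + 1 - 1) / 2 = t := by
    rw [Nat.add_sub_cancel, mul_comm, ht]; omega
  have h2 : (k + 1) * (k + 1 + 1) / 2 = t + (k + 1) := by
    rw [show (k + 1) * (k + 1 + 1) = 2 * (t + (k + 1)) by linarith]; omega
  rw [h1, h2, Nat.add_sub_cancel, ht, Even.neg_one_pow ⟨t, rfl⟩, one_mul, neg_pow, ← pow_mul, ht,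
    ← two_mul, pow_mul, hd, neg_pow (3 : K), pow_add]
  ring

end

theorem stmt13 (n : ℕ) (hn : 1 ≤ n) (m : ℚ) :
    res (n - 1) n ((rpol n).map (Int.castRingHom ℚ)) (fpol m n) =
      3 ^ (n * (n - 1) / 2) * (-1) ^ (n * (n + 1) / 2) := by
  obtain ⟨z, hz⟩ : ∃ z : ℂ, z ^ 2 = z - 1 := by
    obtain ⟨s, hs⟩ := IsAlgClosed.exists_pow_nat_eq (-3 : ℂ) two_pos
    exact ⟨(1 + s) / 2, by linear_combination hs / 4⟩
  have hr : ((rpol n).map (Int.castRingHom ℚ)).map (algebraMap ℚ ℂ) =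
      (rpol n).map (Int.castRingHom ℂ) := by
    rw [Polynomial.map_map]
    congr 1
  apply (algebraMap ℚ ℂ).injective
  rw [res_eq_resultant, ← resultant_map_map, hr, map_fpol hz, resultant_add_mul_right,
    resultant_rpol_X_add_C_pow hz (by norm_num) hn]
  · simp
  · simp
  · exact natDegree_map_le.trans (natDegree_rpol_le n)
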